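/- arXiv:2506.05900 — 2 statements merged into one kernel-verified Lean document; each statement's English description precedes it below -/
import Mathlib

section
/- The Jensen–Shannon distance between column distributions has sensitivity greater than 1/2. Precisely: there exist a finite value domain V with two distinct values a, a', and for all sufficiently large n the following holds: if D is a dataset of n tuples all with attribute value a, D_c = {t} ⊆ D a singleton cluster, and D' = D + {t'}, D_c' = D_c + {t'} with A(t') = a', then d_JS(P_A(D), P_A(D_c)) = 0 while d_JS(P_A(D'), P_A(D_c')) > 1/2; in particular the sensitivity of d_JS exceeds 1/2 (and its range is contained in [0,1]). -/
noncomputable section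

/-- Shannon entropy (base 2) of a distribution `p` on a finite set, with the
convention `0 · log₂ 0 = 0` (automatic since `Real.logb 2 0 = 0`). -/
def entropy2 {V : Type*} [Fintype V] (p : V → ℝ) : ℝ :=
  -∑ a : V, p a * Real.logb 2 (p a)

/-- Jensen–Shannon divergence of two distributions on a finite set. -/
def JSD {V : Type*} [Fintype V] (p q : V → ℝ) : ℝ :=
  entropy2 (fun a => (p a + q a) / 2) - (entropy2 p + entropy2 q) / 2

/-- Jensen–Shannon distance. -/
def dJS {V : Type*} [Fintype V] (p q : V → ℝ) : ℝ :=
  Real.sqrt (JSD p q)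

/-- Empirical distribution of the `A`-column of a dataset `D`. -/
def PA {T V : Type*} [DecidableEq V] (A : T → V) (D : Multiset T) : V → ℝ :=
  fun a => ((D.map A).count a : ℝ) / (Multiset.card D : ℝ)

lemma entropy2_bool (p : Bool → ℝ) (h : p false = 1 - p true) :
    entropy2 p = Real.binEntropy (p true) / Real.log 2 := by
  unfold entropy2
  rw [Real.binEntropy_eq_negMulLog_add_negMulLog_one_sub]
  simp only [Fintype.sum_bool, h, Real.negMulLog, Real.logb]
  ring

lemma quarter_bound :
    Real.log 2 / 4 < Real.binEntropy ((0 + 1 / 2) / 2) -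
      (Real.binEntropy 0 + Real.binEntropy (1 / 2)) / 2 := by
  have h1 : Real.binEntropy (1 / 2) = Real.log 2 := by
    rw [one_div]; exact Real.binEntropy_two_inv
  have h2 : Real.binEntropy ((0 + 1 / 2) / 2) = 2 * Real.log 2 - 3 / 4 * Real.log 3 := by
    rw [Real.binEntropy_eq_negMulLog_add_negMulLog_one_sub]
    have e1 : ((0 + 1 / 2) / 2 : ℝ) = (2 ^ 2)⁻¹ := by norm_num
    have e2 : (1 - (2 ^ 2)⁻¹ : ℝ) = 3 / 2 ^ 2 := by norm_num
    rw [e1, e2]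
    unfold Real.negMulLog
    rw [Real.log_inv, Real.log_div (by norm_num) (by norm_num), Real.log_pow]
    push_cast
    ring
  have h3 : 3 * Real.log 3 < 5 * Real.log 2 := by
    have : Real.log ((3 : ℝ) ^ 3) < Real.log ((2 : ℝ) ^ 5) :=
      Real.log_lt_log (by norm_num) (by norm_num)
    rw [Real.log_pow, Real.log_pow] at this
    exact_mod_cast this
  rw [h1, h2, Real.binEntropy_zero]
  linarith

lemma eventually_bound : ∃ N : ℕ, ∀ n ≥ N,
    Real.log 2 / 4 < Real.binEntropy ((1 / ((n : ℝ) + 1) + 1 / 2) / 2) -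
      (Real.binEntropy (1 / ((n : ℝ) + 1)) + Real.binEntropy (1 / 2)) / 2 := by
  have hc : Continuous (fun x : ℝ => Real.binEntropy ((x + 1 / 2) / 2) -
      (Real.binEntropy x + Real.binEntropy (1 / 2)) / 2) := by
    have := Real.binEntropy_continuous
    fun_prop
  have ht := (hc.tendsto 0).comp (tendsto_one_div_add_atTop_nhds_zero_nat (𝕜 := ℝ))
  exact Filter.eventually_atTop.1 (ht.eventually (lt_mem_nhds quarter_bound))

lemma term_bound (x y : ℝ) (hx : 0 ≤ x) (hy : 0 ≤ y) :
    (x * Real.logb 2 x + y * Real.logb 2 y) / 2 - (x + y) / 2 ≤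
      (x + y) / 2 * Real.logb 2 ((x + y) / 2) := by
  have key : ∀ u v : ℝ, 0 ≤ u → 0 ≤ v → u * Real.logb 2 u ≤ u * Real.logb 2 (u + v) := by
    intro u v hu hv
    rcases hu.eq_or_lt with rfl | hu
    · simp
    · exact mul_le_mul_of_nonneg_left
        (Real.logb_le_logb_of_le (by norm_num) hu (by linarith)) hu.le
  rcases (add_nonneg hx hy).eq_or_lt with h | h
  · have h1 : x = 0 := by linarith
    have h2 : y = 0 := by linarith
    simp [h1, h2]
  · rw [Real.logb_div h.ne' (by norm_num), Real.logb_self_eq_one (by norm_num)]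
    have h1 := key x y hx hy
    have h2 := key y x hy hx
    rw [add_comm y x] at h2
    linarith

/-- The Jensen–Shannon distance between column distributions has sensitivity
greater than `1/2`: there is a finite value domain with two distinct values `a ≠ a'`
such that, for all sufficiently large `n`, adding to a dataset of `n` tuples all
valued `a` (with a singleton cluster) one tuple valued `a'` changes `d_JS` from `0`
to more than `1/2`.  Moreover `d_JS` of probability distributions lies in `[0,1]`. -/
theorem js_high_sensitivity :
    (∃ (V : Type) (fV : Fintype V) (dV : DecidableEq V) (a a' : V),
      a ≠ a' ∧
      ∃ N : ℕ, ∀ n ≥ N, ∀ (T : Type) (A : T → V) (D : Multiset T) (t t' : T),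
        Multiset.card D = n → (∀ s ∈ D, A s = a) → t ∈ D → A t' = a' →
        @dJS V fV (@PA T V dV A D) (@PA T V dV A {t}) = 0 ∧
        1 / 2 < @dJS V fV (@PA T V dV A (t' ::ₘ D)) (@PA T V dV A (t' ::ₘ {t}))) ∧
    (∀ (V : Type) [Fintype V] (p q : V → ℝ),
      (∀ a, 0 ≤ p a) → (∑ a, p a) = 1 → (∀ a, 0 ≤ q a) → (∑ a, q a) = 1 →
      0 ≤ dJS p q ∧ dJS p q ≤ 1) := by
  refine ⟨?_, ?_⟩
  · obtain ⟨N, hN⟩ := eventually_bound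
    refine ⟨Bool, inferInstance, inferInstance, false, true, by decide, N, ?_⟩
    intro n hn T A D t t' hcard hD ht ht'
    have hDm : D.map A = Multiset.replicate n false := by
      rw [Multiset.map_congr rfl hD, Multiset.map_const', hcard]
    have hn0 : n ≠ 0 := by
      rintro rfl
      rw [Multiset.card_eq_zero] at hcard
      simp [hcard] at ht
    have hn0' : (n : ℝ) ≠ 0 := by exact_mod_cast hn0
    have hn1 : (n : ℝ) + 1 ≠ 0 := by positivity
    have hAt := hD t ht
    constructor
    · have e : PA A D = PA A {t} := by
        funext b
        cases b <;> simp [PA, hDm, hcard, hAt, hn0', Multiset.count_replicate]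
      rw [e]
      simp [dJS, JSD]
    · have p1 : PA A (t' ::ₘ D) true = 1 / ((n : ℝ) + 1) := by
        simp [PA, hDm, hcard, ht', Multiset.count_replicate]
      have p0 : PA A (t' ::ₘ D) false = 1 - 1 / ((n : ℝ) + 1) := by
        simp [PA, hDm, hcard, ht', Multiset.count_replicate]
        field_simp
        ring
      have q1 : PA A (t' ::ₘ {t}) true = 1 / 2 := by
        simp [PA, hAt, ht']
      have q0 : PA A (t' ::ₘ {t}) false = 1 - 1 / 2 := by
        simp [PA, hAt, ht', Multiset.count_singleton]
        norm_num
      have hl : 0 < Real.log 2 := Real.log_pos (by norm_num)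
      have hb := hN n hn
      unfold dJS
      apply Real.lt_sqrt_of_sq_lt
      unfold JSD
      rw [entropy2_bool (fun a => (PA A (t' ::ₘ D) a + PA A (t' ::ₘ {t}) a) / 2)
          (by simp only [p1, p0, q1, q0]; ring),
        entropy2_bool _ (by rw [p1, p0]), entropy2_bool _ (by rw [q1, q0])]
      simp only [p1, q1]
      have : (1 / 2 : ℝ) ^ 2 = (Real.log 2 / 4) / Real.log 2 := by
        field_simp; norm_num
      rw [this]
      refine (div_lt_div_of_pos_right hb hl).trans_eq ?_
      ring
  · intro V _ p q hp hp1 hq hq1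
    refine ⟨Real.sqrt_nonneg _, ?_⟩
    unfold dJS
    rw [Real.sqrt_le_one]
    unfold JSD entropy2
    have h := Finset.sum_le_sum (fun a (_ : a ∈ Finset.univ) =>
      term_bound (p a) (q a) (hp a) (hq a))
    rw [Finset.sum_sub_distrib, ← Finset.sum_div, ← Finset.sum_div, Finset.sum_add_distrib,
      Finset.sum_add_distrib, hp1, hq1] at h
    linarith
end
end

section
/- The global diversity function Div_p has sensitivity at most 1, and its range is [0, R_Div]. Precisely: (a) for every clustering function f : T → C with |C| ≥ 2, every attribute combination AC, every dataset D and tuple t, writing D' = D + {t}, one has |Div_p(D', f, AC) − Div_p(D, f, AC)| ≤ 1; and (b) 0 ≤ Div_p(D, f, AC) ≤ R_Div, where R_Div = (1/binom(|C|,2)) Σ_{i=1}^{|C|} (|C| − i)·|D_{c_i}| and c_1, …, c_{|C|} is an ordering of the cluster labels with |D_{c_1}| ≤ |D_{c_2}| ≤ … ≤ |D_{c_{|C|}}|; moreover R_Div is attained when AC assigns a distinct attribute to each cluster. -/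
noncomputable section

/-- The cluster of label `c`: the sub-multiset of tuples of `D` mapped to `c` by `f`. -/
def cl {T C : Type*} [DecidableEq C] (D : Multiset T) (f : T → C) (c : C) : Multiset T :=
  D.filter (fun t => f t = c)

/-- The pairwise diversity `d(D, f, c, c', A_c, A_{c'}) = min{|D_c|, |D_{c'}|} · w`,
where `w = 1` if `A_c ≠ A_{c'}`, and otherwise (with `A = A_c = A_{c'}`)
`w = (1/2) Σ_{a∈V} | cnt_{A=a}(D_c)/max{|D_c|,1} − cnt_{A=a}(D_{c'})/max{|D_{c'}|,1} |`. -/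
def pdiv {T V C : Type*} [Fintype V] [DecidableEq V] [DecidableEq C]
    (D : Multiset T) (f : T → C) (c c' : C) (Ac Ac' : T → V) : ℝ :=
  (min (Multiset.card (cl D f c)) (Multiset.card (cl D f c')) : ℝ) *
    @ite ℝ (Ac = Ac') (Classical.propDecidable _)
      ((1 / 2) * ∑ a : V,
        |(((cl D f c).map Ac).count a : ℝ) / (max (Multiset.card (cl D f c)) 1 : ℝ) -
          (((cl D f c').map Ac).count a : ℝ) / (max (Multiset.card (cl D f c')) 1 : ℝ)|)
      1

/-- Global diversity: `Div_p(D, f, AC) = (1/binom(|C|,2)) Σ_{{c,c'}⊆C, c≠c'}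
d(D, f, c, c', AC(c), AC(c'))`, where the sum over unordered pairs of distinct
labels is written as half the sum over ordered pairs of distinct labels
(legitimate since `d` is symmetric). -/
def Divp {T V C : Type*} [Fintype V] [DecidableEq V] [Fintype C] [DecidableEq C]
    (D : Multiset T) (f : T → C) (AC : C → (T → V)) : ℝ :=
  (1 / ((Fintype.card C).choose 2 : ℝ)) *
    ((1 / 2) * ∑ p ∈ (Finset.univ : Finset C).offDiag, pdiv D f p.1 p.2 (AC p.1) (AC p.2))

/-- `R_Div = (1/binom(|C|,2)) Σ_{i=1}^{|C|} (|C| − i)·|D_{c_i}|` for an ordering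
`e` of the labels with nondecreasing cluster sizes. -/
def RDiv {T C : Type*} [Fintype C] [DecidableEq C]
    (D : Multiset T) (f : T → C) (e : Fin (Fintype.card C) ≃ C) : ℝ :=
  (1 / ((Fintype.card C).choose 2 : ℝ)) *
    ∑ i : Fin (Fintype.card C),
      ((Fintype.card C - (i.val + 1) : ℕ) : ℝ) * (Multiset.card (cl D f (e i)) : ℝ)

/-- Weighted total variation distance between two multisets. -/
def tvd {T V : Type*} [Fintype V] [DecidableEq V] (X Y : Multiset T) (A : T → V) : ℝ :=
  (1 / 2) * ∑ a : V,
        |((X.map A).count a : ℝ) / (max (Multiset.card X) 1 : ℝ) -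
          ((Y.map A).count a : ℝ) / (max (Multiset.card Y) 1 : ℝ)|

theorem sum_cnt {T V : Type*} [Fintype V] [DecidableEq V] (X : Multiset T) (A : T → V) :
    ∑ a : V, ((X.map A).count a : ℝ) = (Multiset.card X : ℝ) := by
  have h := Multiset.sum_count_eq_card (s := Finset.univ) (m := X.map A) (by simp)
  rw [Multiset.card_map] at h
  exact_mod_cast h

theorem sum_frac_le {T V : Type*} [Fintype V] [DecidableEq V] (X : Multiset T) (A : T → V) :
    ∑ a : V, ((X.map A).count a : ℝ) / (max (Multiset.card X) 1 : ℝ) ≤ 1 := by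
  rw [← Finset.sum_div, sum_cnt]
  exact div_le_one_of_le₀ (le_max_left _ _) (by positivity)

theorem tvd_nonneg {T V : Type*} [Fintype V] [DecidableEq V] (X Y : Multiset T) (A : T → V) :
    0 ≤ tvd X Y A := by
  unfold tvd
  positivity

theorem tvd_comm {T V : Type*} [Fintype V] [DecidableEq V] (X Y : Multiset T) (A : T → V) :
    tvd X Y A = tvd Y X A := by
  unfold tvd
  congr 1
  exact Finset.sum_congr rfl fun a _ => abs_sub_comm _ _

theorem tvd_le_one {T V : Type*} [Fintype V] [DecidableEq V] (X Y : Multiset T) (A : T → V) :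
    tvd X Y A ≤ 1 := by
  unfold tvd
  have h : ∑ a : V, |((X.map A).count a : ℝ) / (max (Multiset.card X) 1 : ℝ) -
          ((Y.map A).count a : ℝ) / (max (Multiset.card Y) 1 : ℝ)| ≤
      ∑ a : V, (((X.map A).count a : ℝ) / (max (Multiset.card X) 1 : ℝ) +
          ((Y.map A).count a : ℝ) / (max (Multiset.card Y) 1 : ℝ)) := by
    refine Finset.sum_le_sum fun a _ => ?_
    refine (abs_sub _ _).trans (le_of_eq ?_)
    rw [abs_of_nonneg (by positivity), abs_of_nonneg (by positivity)]
  rw [Finset.sum_add_distrib] at h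
  have h1 := sum_frac_le X A
  have h2 := sum_frac_le Y A
  linarith

theorem half_sum_diff {V : Type*} [Fintype V] (k k' : ℝ) (hk : 0 ≤ k) (hk' : 0 ≤ k')
    (u v b d : V → ℝ) (hb : ∀ a, 0 ≤ b a) (hd : ∀ a, 0 ≤ d a)
    (h : ∀ a, k' * u a - k * v a = b a - d a)
    (hbs : ∑ a, b a ≤ 1) (hds : ∑ a, d a ≤ 1) :
    |k' * ((1 / 2) * ∑ a, |u a|) - k * ((1 / 2) * ∑ a, |v a|)| ≤ 1 := by
  have e : k' * ((1 / 2) * ∑ a, |u a|) - k * ((1 / 2) * ∑ a, |v a|) =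
      (1 / 2) * ∑ a, (|k' * u a| - |k * v a|) := by
    simp only [abs_mul, abs_of_nonneg hk, abs_of_nonneg hk', Finset.sum_sub_distrib,
      ← Finset.mul_sum]
    ring
  rw [e, abs_mul]
  have h2 : |∑ a, (|k' * u a| - |k * v a|)| ≤ ∑ a, (b a + d a) := by
    refine (Finset.abs_sum_le_sum_abs _ _).trans (Finset.sum_le_sum fun a _ => ?_)
    refine (abs_abs_sub_abs_le_abs_sub _ _).trans ?_
    rw [h a]
    refine (abs_sub _ _).trans (le_of_eq ?_)
    rw [abs_of_nonneg (hb a), abs_of_nonneg (hd a)]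
  rw [Finset.sum_add_distrib] at h2
  rw [abs_of_nonneg (by norm_num : (0 : ℝ) ≤ 1 / 2)]
  linarith

theorem tvd_cons {T V : Type*} [Fintype V] [DecidableEq V] (X Y : Multiset T) (A : T → V)
    (t : T) :
    |(min (Multiset.card (t ::ₘ X)) (Multiset.card Y) : ℝ) * tvd (t ::ₘ X) Y A -
      (min (Multiset.card X) (Multiset.card Y) : ℝ) * tvd X Y A| ≤ 1 := by
  have hdel : ∑ a : V, (if a = A t then (1 : ℝ) else 0) = 1 := by simp
  have hcnt : ∀ a, ((((t ::ₘ X).map A).count a : ℕ) : ℝ) =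
      ((X.map A).count a : ℝ) + (if a = A t then (1 : ℝ) else 0) := by
    intro a
    rw [Multiset.map_cons, Multiset.count_cons]
    push_cast
    rfl
  have hcard : ((Multiset.card (t ::ₘ X) : ℕ) : ℝ) = (Multiset.card X : ℝ) + 1 := by
    simp
  have hm0 : (0 : ℝ) ≤ (Multiset.card X : ℝ) := by positivity
  unfold tvd
  have hmax : max ((Multiset.card X : ℝ) + 1) 1 = (Multiset.card X : ℝ) + 1 :=
    max_eq_left (by linarith)
  rw [hcard, hmax]
  rcases lt_or_ge (Multiset.card X) (Multiset.card Y) with hlt | hge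
  · have h1 : (Multiset.card X : ℝ) + 1 ≤ (Multiset.card Y : ℝ) := by exact_mod_cast hlt
    rw [min_eq_left h1, min_eq_left (by linarith)]
    refine half_sum_diff _ _ (by positivity) (by positivity) _ _
      (fun a => if a = A t then (1 : ℝ) else 0)
      (fun a => ((Y.map A).count a : ℝ) / (max (Multiset.card Y) 1 : ℝ))
      (fun a => by positivity) (fun a => by positivity) ?_ hdel.le (sum_frac_le Y A)
    intro a
    rw [hcnt]
    have hx : (Multiset.card X : ℝ) *
        (((X.map A).count a : ℝ) / (max (Multiset.card X) 1 : ℝ)) = ((X.map A).count a : ℝ) := by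
      rcases Nat.eq_zero_or_pos (Multiset.card X) with h0 | hpos
      · rw [Multiset.card_eq_zero] at h0
        subst h0
        simp
      · have : (1 : ℝ) ≤ (Multiset.card X : ℝ) := by exact_mod_cast hpos
        rw [max_eq_left this]
        field_simp
    have hx' : ((Multiset.card X : ℝ) + 1) * ((((X.map A).count a : ℝ) +
        (if a = A t then (1 : ℝ) else 0)) / ((Multiset.card X : ℝ) + 1)) =
        ((X.map A).count a : ℝ) + (if a = A t then (1 : ℝ) else 0) := by
      field_simp
    rw [mul_sub, mul_sub, hx, hx']
    ring
  · have h1 : (Multiset.card Y : ℝ) ≤ (Multiset.card X : ℝ) := by exact_mod_cast hge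
    rw [min_eq_right h1, min_eq_right (by linarith)]
    rcases Nat.eq_zero_or_pos (Multiset.card Y) with h0 | hpos
    · simp [h0]
    have hn : (1 : ℝ) ≤ (Multiset.card Y : ℝ) := by exact_mod_cast hpos
    have hm : (1 : ℝ) ≤ (Multiset.card X : ℝ) := hn.trans h1
    have hmp : (0 : ℝ) < (Multiset.card X : ℝ) := by linarith
    have hr : (Multiset.card Y : ℝ) / ((Multiset.card X : ℝ) + 1) ≤ 1 :=
      div_le_one_of_le₀ (by linarith) (by positivity)
    refine half_sum_diff _ _ (by positivity) (by positivity) _ _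
      (fun a => (Multiset.card Y : ℝ) / ((Multiset.card X : ℝ) + 1) *
        (if a = A t then (1 : ℝ) else 0))
      (fun a => (Multiset.card Y : ℝ) / ((Multiset.card X : ℝ) + 1) *
        (((X.map A).count a : ℝ) / (max (Multiset.card X) 1 : ℝ)))
      (fun a => by positivity) (fun a => by positivity) ?_ ?_ ?_
    · intro a
      rw [hcnt, max_eq_left hm]
      generalize (if a = A t then (1 : ℝ) else 0) = δ
      field_simp
      ring
    · rw [← Finset.mul_sum, hdel]
      linarith
    · rw [← Finset.mul_sum]
      exact mul_le_one₀ hr (Finset.sum_nonneg fun a _ => by positivity) (sum_frac_le X A)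

theorem min_cons (m n : ℝ) : |min (m + 1) n * 1 - min m n * 1| ≤ 1 := by
  rw [abs_le]
  constructor <;> rcases min_cases (m + 1) n with h | h <;> rcases min_cases m n with h' | h' <;>
    linarith [h.1, h'.1]

theorem pdiv_eq {T V C : Type*} [Fintype V] [DecidableEq V] [DecidableEq C]
    (D : Multiset T) (f : T → C) (c c' : C) (A A' : T → V) :
    pdiv D f c c' A A' = (min (Multiset.card (cl D f c)) (Multiset.card (cl D f c')) : ℝ) *
      @ite ℝ (A = A') (Classical.propDecidable _) (tvd (cl D f c) (cl D f c') A) 1 := rfl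

theorem pdiv_comm {T V C : Type*} [Fintype V] [DecidableEq V] [DecidableEq C]
    (D : Multiset T) (f : T → C) (c c' : C) (A A' : T → V) :
    pdiv D f c c' A A' = pdiv D f c' c A' A := by
  rw [pdiv_eq, pdiv_eq, min_comm]
  by_cases h : A = A'
  · subst h
    rw [if_pos rfl, if_pos rfl, tvd_comm]
  · rw [if_neg h, if_neg (Ne.symm h)]

theorem pdiv_nonneg {T V C : Type*} [Fintype V] [DecidableEq V] [DecidableEq C]
    (D : Multiset T) (f : T → C) (c c' : C) (A A' : T → V) :
    0 ≤ pdiv D f c c' A A' := by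
  rw [pdiv_eq]
  refine mul_nonneg (by positivity) ?_
  split_ifs
  · exact tvd_nonneg _ _ _
  · exact zero_le_one

theorem pdiv_le {T V C : Type*} [Fintype V] [DecidableEq V] [DecidableEq C]
    (D : Multiset T) (f : T → C) (c c' : C) (A A' : T → V) :
    pdiv D f c c' A A' ≤ (min (Multiset.card (cl D f c)) (Multiset.card (cl D f c')) : ℝ) := by
  rw [pdiv_eq]
  refine mul_le_of_le_one_right (by positivity) ?_
  split_ifs
  · exact tvd_le_one _ _ _
  · exact le_rfl

theorem cl_cons_self {T C : Type*} [DecidableEq C] (D : Multiset T) (f : T → C) (t : T) :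
    cl (t ::ₘ D) f (f t) = t ::ₘ cl D f (f t) := by
  unfold cl
  exact Multiset.filter_cons_of_pos _ rfl

theorem cl_cons_ne {T C : Type*} [DecidableEq C] (D : Multiset T) (f : T → C) (t : T) (c : C)
    (h : f t ≠ c) : cl (t ::ₘ D) f c = cl D f c := by
  unfold cl
  exact Multiset.filter_cons_of_neg _ h

theorem pdiv_sens_left {T V C : Type*} [Fintype V] [DecidableEq V] [DecidableEq C]
    (D : Multiset T) (f : T → C) (t : T) (c' : C) (A A' : T → V) (h : f t ≠ c') :
    |pdiv (t ::ₘ D) f (f t) c' A A' - pdiv D f (f t) c' A A'| ≤ 1 := by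
  rw [pdiv_eq, pdiv_eq, cl_cons_self, cl_cons_ne D f t c' h]
  split_ifs
  · exact tvd_cons _ _ _ _
  · rw [Multiset.card_cons]
    push_cast
    exact min_cons _ _

theorem pdiv_sens {T V C : Type*} [Fintype V] [DecidableEq V] [DecidableEq C]
    (D : Multiset T) (f : T → C) (t : T) (c c' : C) (A A' : T → V) (h : c ≠ c') :
    |pdiv (t ::ₘ D) f c c' A A' - pdiv D f c c' A A'| ≤ 1 := by
  by_cases h1 : f t = c
  · subst h1
    exact pdiv_sens_left D f t c' A A' h
  by_cases h2 : f t = c'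
  · subst h2
    rw [pdiv_comm, pdiv_comm D]
    exact pdiv_sens_left D f t c A' A (Ne.symm h)
  rw [pdiv_eq, pdiv_eq, cl_cons_ne D f t c h1, cl_cons_ne D f t c' h2]
  simp

theorem sum_min_fin (N : ℕ) (s : Fin N → ℝ) (hs : ∀ i j, i ≤ j → s i ≤ s j) :
    (1 / 2) * ∑ p ∈ (Finset.univ : Finset (Fin N)).offDiag, min (s p.1) (s p.2) =
      ∑ i : Fin N, ((N - (i.val + 1) : ℕ) : ℝ) * s i := by
  have h1 : ∑ p ∈ (Finset.univ : Finset (Fin N)).offDiag, min (s p.1) (s p.2) =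
      ∑ i : Fin N, ∑ j : Fin N, ((if i < j then s i else 0) + (if j < i then s j else 0)) := by
    rw [← Fintype.sum_prod_type'
      (fun i j : Fin N => (if i < j then s i else 0) + (if j < i then s j else 0))]
    have hf : (Finset.univ : Finset (Fin N)).offDiag =
        Finset.univ.filter (fun p : Fin N × Fin N => p.1 ≠ p.2) := by
      ext p
      simp
    rw [hf, Finset.sum_filter]
    refine Finset.sum_congr rfl fun p _ => ?_
    rcases lt_trichotomy p.1 p.2 with h | h | h
    · rw [if_pos h.ne, if_pos h, if_neg h.not_gt, min_eq_left (hs _ _ h.le), add_zero]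
    · simp [h]
    · rw [if_pos h.ne', if_neg h.not_gt, if_pos h, min_eq_right (hs _ _ h.le), zero_add]
  have h2 : ∀ i : Fin N, ∑ j : Fin N, (if i < j then s i else 0) =
      ((N - (i.val + 1) : ℕ) : ℝ) * s i := by
    intro i
    rw [← Finset.sum_filter, Finset.sum_const, nsmul_eq_mul]
    congr 2
    have : Finset.univ.filter (fun j => i < j) = Finset.Ioi i := by
      ext j
      simp
    rw [this, Fin.card_Ioi]
    omega
  rw [h1]
  simp only [Finset.sum_add_distrib]
  rw [Finset.sum_comm (f := fun i j : Fin N => if j < i then s j else 0)]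
  simp only [h2]
  ring

theorem RDiv_eq {T C : Type*} [Fintype C] [DecidableEq C]
    (D : Multiset T) (f : T → C) (e : Fin (Fintype.card C) ≃ C)
    (he : ∀ i j : Fin (Fintype.card C), i ≤ j →
        Multiset.card (cl D f (e i)) ≤ Multiset.card (cl D f (e j))) :
    RDiv D f e = (1 / ((Fintype.card C).choose 2 : ℝ)) *
    ((1 / 2) * ∑ p ∈ (Finset.univ : Finset C).offDiag,
      (min (Multiset.card (cl D f p.1)) (Multiset.card (cl D f p.2)) : ℝ)) := by
  unfold RDiv
  rw [← sum_min_fin _ (fun i => (Multiset.card (cl D f (e i)) : ℝ))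
    (fun i j h => by exact_mod_cast he i j h)]
  congr 2
  refine Finset.sum_equiv (e.prodCongr e) ?_ ?_
  · intro p
    simp
  · intro p _
    rfl

/-- The global diversity `Div_p` has sensitivity at most `1` and range `[0, R_Div]`,
with `R_Div` attained when `AC` assigns a distinct attribute to each cluster. -/
theorem divp_sensitivity_and_range {T V C : Type*} [Fintype V] [DecidableEq V]
    [Fintype C] [DecidableEq C] (hC : 2 ≤ Fintype.card C)
    (f : T → C) (AC : C → (T → V)) :
    (∀ (D : Multiset T) (t : T), |Divp (t ::ₘ D) f AC - Divp D f AC| ≤ 1) ∧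
    (∀ (D : Multiset T) (e : Fin (Fintype.card C) ≃ C),
      (∀ i j : Fin (Fintype.card C), i ≤ j →
        Multiset.card (cl D f (e i)) ≤ Multiset.card (cl D f (e j))) →
      (0 ≤ Divp D f AC ∧ Divp D f AC ≤ RDiv D f e ∧
        (Function.Injective AC → Divp D f AC = RDiv D f e))) := by
  have hch : (0 : ℝ) < ((Fintype.card C).choose 2 : ℝ) := by
    exact_mod_cast Nat.choose_pos hC
  refine ⟨?_, ?_⟩
  · intro D t
    unfold Divp
    rw [← mul_sub, ← mul_sub, ← Finset.sum_sub_distrib, abs_mul, abs_mul,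
      abs_of_nonneg (by positivity), abs_of_nonneg (by norm_num : (0 : ℝ) ≤ 1 / 2)]
    have h1 : |∑ p ∈ (Finset.univ : Finset C).offDiag,
        (pdiv (t ::ₘ D) f p.1 p.2 (AC p.1) (AC p.2) - pdiv D f p.1 p.2 (AC p.1) (AC p.2))| ≤
        ∑ p ∈ (Finset.univ : Finset C).offDiag, (1 : ℝ) := by
      refine (Finset.abs_sum_le_sum_abs _ _).trans (Finset.sum_le_sum fun p hp => ?_)
      exact pdiv_sens D f t _ _ _ _ (Finset.mem_offDiag.1 hp).2.2
    have h2 : ∑ p ∈ (Finset.univ : Finset C).offDiag, (1 : ℝ) =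
        2 * ((Fintype.card C).choose 2 : ℝ) := by
      rw [Finset.sum_const, Finset.offDiag_card, Finset.card_univ, nsmul_eq_mul, mul_one,
        Nat.cast_choose_two, Nat.cast_sub (Nat.le_mul_self _)]
      push_cast
      ring
    rw [h2] at h1
    rw [one_div, inv_mul_le_iff₀ hch]
    linarith
  · intro D e he
    rw [RDiv_eq D f e he]
    unfold Divp
    refine ⟨?_, ?_, ?_⟩
    · have := Finset.sum_nonneg fun p (_ : p ∈ (Finset.univ : Finset C).offDiag) =>
        pdiv_nonneg D f p.1 p.2 (AC p.1) (AC p.2)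
      positivity
    · gcongr with p hp
      exact pdiv_le _ _ _ _ _ _
    · intro hinj
      congr 2
      refine Finset.sum_congr rfl fun p hp => ?_
      rw [pdiv_eq, if_neg (hinj.ne (Finset.mem_offDiag.1 hp).2.2), mul_one]
end
end
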